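/- If i, j, k ∈ {1,…,14} have pairwise distinct residues modulo 7 and these residues form a line of the Fano plane, then the element t_i t_j t_k t_i t_j of 𝒢 lies in the subgroup N = ⟨x, y⟩ (i.e. there exists γ ∈ N with γ = t_i t_j t_k t_i t_j). -/

import Mathlib

/-!
Symmetric generation of `M₂₂` (Hasan–Lim).  `G` is the quotient of the free
group on three generators `x, y, t` by the normal closure of the relators
`x^7, y^2, (xy)^3, [x,y]^4, t^2, [t^{x^2}, y x⁻¹], [t, y],
 (y t^{x^2})^5, (x y x^2 t^x)^5, (x t)^8`,
where `a ^ b := b⁻¹ a b` and `[a, b] := a⁻¹ b⁻¹ a b`.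
-/

namespace M22

abbrev F := FreeGroup (Fin 3)
def fx : F := FreeGroup.of 0
def fy : F := FreeGroup.of 1
def ft : F := FreeGroup.of 2

/-- conjugation `a ^ b = b⁻¹ * a * b` -/
def fconj (a b : F) : F := b⁻¹ * a * b
/-- commutator `[a, b] = a⁻¹ * b⁻¹ * a * b` -/
def fcomm (a b : F) : F := a⁻¹ * b⁻¹ * a * b

def rels : Set F :=
  {fx ^ 7, fy ^ 2, (fx * fy) ^ 3, (fcomm fx fy) ^ 4, ft ^ 2,
   fcomm (fconj ft (fx ^ 2)) (fy * fx⁻¹), fcomm ft fy,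
   (fy * fconj ft (fx ^ 2)) ^ 5, (fx * fy * fx ^ 2 * fconj ft fx) ^ 5,
   (fx * ft) ^ 8}

abbrev G := PresentedGroup rels

def x : G := PresentedGroup.of 0
def y : G := PresentedGroup.of 1
def t : G := PresentedGroup.of 2

/-- The symmetric generators `t₁, …, t₁₄`: for `1 ≤ i ≤ 7`, `tᵢ = t ^ (xⁱ)`,
and for `1 ≤ k ≤ 7`, `t₍₇₊ₖ₎ = t ^ (x⁵ y x^(k-1))`; the index is read modulo
`14` with representatives `1, …, 14`. -/
def tt (i : ℕ) : G :=
  let j := (i - 1) % 14 + 1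
  if j ≤ 7 then (x ^ j)⁻¹ * t * x ^ j
  else (x ^ 5 * y * x ^ (j - 8))⁻¹ * t * (x ^ 5 * y * x ^ (j - 8))

/-- the residue of `n` modulo `7`, taken in `{1, …, 7}` -/
def red7 (n : ℕ) : ℕ := (n - 1) % 7 + 1

/-- `{a, b, c}` is a line of the Fano plane on points `{1, …, 7}`; the lines
are the seven triples `{m, m+2, m+3}` for `m = 1, …, 7`, entries reduced
modulo `7` into `{1, …, 7}`. -/
def IsFanoLine (a b c : ℕ) : Prop :=
  ∃ m ∈ Finset.Icc 1 7,
    ({a, b, c} : Finset ℕ) = {red7 m, red7 (m + 2), red7 (m + 3)}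

/-- the control subgroup `N = ⟨x, y⟩` of `G` -/
def N : Subgroup G := Subgroup.closure {x, y}

/-! ### Relations of the presentation -/

theorem mk_rel {r : F} (h : r ∈ rels) : PresentedGroup.mk rels r = 1 :=
  PresentedGroup.one_of_mem h

theorem mk_fx : PresentedGroup.mk rels fx = x := rfl
theorem mk_fy : PresentedGroup.mk rels fy = y := rfl
theorem mk_ft : PresentedGroup.mk rels ft = t := rfl

theorem x_pow : x ^ 7 = 1 := by
  have h := mk_rel (r := fx ^ 7) (by simp [rels])
  simpa [mk_fx] using h

theorem y_sq : y * y = 1 := by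
  have h := mk_rel (r := fy ^ 2) (by simp [rels])
  simpa [mk_fy, pow_two] using h

theorem t_sq : t * t = 1 := by
  have h := mk_rel (r := ft ^ 2) (by simp [rels])
  simpa [mk_ft, pow_two] using h

theorem xy_cube : (x * y) ^ 3 = 1 := by
  have h := mk_rel (r := (fx * fy) ^ 3) (by simp [rels])
  simpa [mk_fx, mk_fy] using h

theorem comm_four : (x⁻¹ * y⁻¹ * x * y) ^ 4 = 1 := by
  have h := mk_rel (r := (fcomm fx fy) ^ 4) (by simp [rels])
  simpa [mk_fx, mk_fy, fcomm] using h

theorem t_y : t⁻¹ * y⁻¹ * t * y = 1 := by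
  have h := mk_rel (r := fcomm ft fy) (by simp [rels])
  simpa only [map_mul, map_inv, mk_ft, mk_fy, fcomm] using h

theorem t2_rel : ((x ^ 2)⁻¹ * t * x ^ 2)⁻¹ * (y * x⁻¹)⁻¹ * ((x ^ 2)⁻¹ * t * x ^ 2) * (y * x⁻¹) = 1 := by
  have h := mk_rel (r := fcomm (fconj ft (fx ^ 2)) (fy * fx⁻¹)) (by simp [rels])
  simpa only [map_mul, map_inv, map_pow, mk_ft, mk_fy, mk_fx, fcomm, fconj] using h

theorem rel_A : (y * ((x ^ 2)⁻¹ * t * x ^ 2)) ^ 5 = 1 := by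
  have h := mk_rel (r := (fy * fconj ft (fx ^ 2)) ^ 5) (by simp [rels])
  simpa only [map_mul, map_inv, map_pow, mk_ft, mk_fy, mk_fx, fcomm, fconj] using h

theorem rel_B : (x * y * x ^ 2 * (x⁻¹ * t * x)) ^ 5 = 1 := by
  have h := mk_rel (r := (fx * fy * fx ^ 2 * fconj ft fx) ^ 5) (by simp [rels])
  simpa only [map_mul, map_inv, map_pow, mk_ft, mk_fy, mk_fx, fcomm, fconj] using h

theorem y_inv : y⁻¹ = y := inv_eq_of_mul_eq_one_right y_sq

/-! ### The action of `x` and `y` on the symmetric generators -/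

/-- conjugation by `x` -/
def cx (a : G) : G := x⁻¹ * a * x
/-- conjugation by `y` -/
def cy (a : G) : G := y⁻¹ * a * y

theorem cx_seven (a : G) : cx (cx (cx (cx (cx (cx (cx a)))))) = a := by
  have h : cx (cx (cx (cx (cx (cx (cx a)))))) = (x ^ 7)⁻¹ * a * x ^ 7 := by
    simp only [cx, pow_succ, pow_zero, mul_inv_rev, one_mul, mul_assoc]
  rw [h, x_pow]; simp

theorem cx_inj {a b : G} (h : cx a = cx b) : a = b := by
  unfold cx at h
  simpa using h

theorem cy_cy (a : G) : cy (cy a) = a := by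
  have h : cy (cy a) = (y * y)⁻¹ * a * (y * y) := by unfold cy; group
  rw [h, y_sq]; simp

/-- `(xy)^3 = 1` -/
theorem c_cube (a : G) : cy (cx (cy (cx (cy (cx a))))) = a := by
  have h : cy (cx (cy (cx (cy (cx a))))) = ((x * y) ^ 3)⁻¹ * a * (x * y) ^ 3 := by
    simp only [cx, cy, pow_succ, pow_zero, mul_inv_rev, one_mul, mul_assoc]
  rw [h, xy_cube]; simp

theorem yxy : y * x * y = x⁻¹ * y * x⁻¹ := by
  have h := xy_cube
  have h2 : x * (y * x * y) * (x * y) = 1 := by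
    rw [← h]; simp only [pow_succ, pow_zero, one_mul, mul_assoc]
  have h3 : y * x * y = x⁻¹ * (x * y)⁻¹ := by
    rw [eq_inv_mul_iff_mul_eq, eq_inv_iff_mul_eq_one]; exact h2
  rw [h3, mul_inv_rev, y_inv]; simp only [mul_assoc]

theorem xxx_four : (x⁻¹ * x⁻¹ * x⁻¹ * y) ^ 4 = 1 := by
  have h : x⁻¹ * y⁻¹ * x * y = x * (x⁻¹ * x⁻¹ * x⁻¹ * y) * x⁻¹ := by
    have := yxy
    rw [y_inv]
    calc x⁻¹ * y * x * y = x⁻¹ * (y * x * y) := by simp only [mul_assoc]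
      _ = _ := by rw [this]; group
  have h4 := comm_four
  rw [h, conj_pow] at h4
  simpa using h4

theorem xxxy_four : (y * x * x * x) ^ 4 = 1 := by
  have h : y * x * x * x = (x⁻¹ * x⁻¹ * x⁻¹ * y)⁻¹ := by
    simp only [mul_inv_rev, inv_inv, y_inv, mul_assoc]
  rw [h, inv_pow, xxx_four, inv_one]

/-- `(yx^3)^4 = 1` -/
theorem c_four (a : G) : cx (cx (cx (cy (cx (cx (cx (cy (cx (cx (cx (cy
    (cx (cx (cx (cy a))))))))))))))) = a := by
  have h : cx (cx (cx (cy (cx (cx (cx (cy (cx (cx (cx (cy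
    (cx (cx (cx (cy a))))))))))))))) = ((y * x * x * x) ^ 4)⁻¹ * a * (y * x * x * x) ^ 4 := by
    simp only [cx, cy, pow_succ, pow_zero, mul_inv_rev, one_mul, mul_assoc]
  rw [h, xxxy_four]; simp

/-- the symmetric generators indexed from `0` to `13` -/
def T (i : Fin 14) : G := tt (i + 1)

theorem T_unfold : T 0 = cx t ∧ T 1 = cx (cx t) ∧ T 2 = cx (cx (cx t)) ∧
    T 3 = cx (cx (cx (cx t))) ∧ T 4 = cx (cx (cx (cx (cx t)))) ∧
    T 5 = cx (cx (cx (cx (cx (cx t))))) ∧ T 6 = t ∧ T 7 = cy (T 4) := by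
  have h6 : T 6 = t := by
    change (x ^ 7)⁻¹ * t * x ^ 7 = t
    rw [x_pow]; simp
  refine ⟨?_, ?_, ?_, ?_, ?_, ?_, h6, ?_⟩
  · change (x ^ 1)⁻¹ * t * x ^ 1 = _
    simp only [cx, pow_succ, pow_zero, mul_inv_rev, one_mul, mul_assoc]
  · change (x ^ 2)⁻¹ * t * x ^ 2 = _
    simp only [cx, pow_succ, pow_zero, mul_inv_rev, one_mul, mul_assoc]
  · change (x ^ 3)⁻¹ * t * x ^ 3 = _
    simp only [cx, pow_succ, pow_zero, mul_inv_rev, one_mul, mul_assoc]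
  · change (x ^ 4)⁻¹ * t * x ^ 4 = _
    simp only [cx, pow_succ, pow_zero, mul_inv_rev, one_mul, mul_assoc]
  · change (x ^ 5)⁻¹ * t * x ^ 5 = _
    simp only [cx, pow_succ, pow_zero, mul_inv_rev, one_mul, mul_assoc]
  · change (x ^ 6)⁻¹ * t * x ^ 6 = _
    simp only [cx, pow_succ, pow_zero, mul_inv_rev, one_mul, mul_assoc]
  · change (x ^ 5 * y * x ^ 0)⁻¹ * t * (x ^ 5 * y * x ^ 0) = y⁻¹ * ((x ^ 5)⁻¹ * t * x ^ 5) * y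
    group

theorem T_high (k : ℕ) (hk : k + 1 < 7) :
    T ⟨k + 1 + 7, by omega⟩ = cx (T ⟨k + 7, by omega⟩) := by
  have e (m : ℕ) (hm : m < 7) : T ⟨m + 7, by omega⟩ =
      (x ^ 5 * y * x ^ m)⁻¹ * t * (x ^ 5 * y * x ^ m) := by
    have h1 : (m + 7 + 1 - 1) % 14 + 1 = m + 8 := by omega
    have h2 : ¬ (m + 8 ≤ 7) := by omega
    change (if (m + 7 + 1 - 1) % 14 + 1 ≤ 7 then _ else _) = _
    rw [h1, if_neg h2]
    rfl
  rw [e _ hk, e k (by omega), cx, pow_succ x k]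
  simp only [mul_inv_rev, mul_assoc]

theorem T8 : T 8 = cx (T 7) := T_high 0 (by omega)
theorem T9 : T 9 = cx (T 8) := T_high 1 (by omega)
theorem T10 : T 10 = cx (T 9) := T_high 2 (by omega)
theorem T11 : T 11 = cx (T 10) := T_high 3 (by omega)
theorem T12 : T 12 = cx (T 11) := T_high 4 (by omega)
theorem T13 : T 13 = cx (T 12) := T_high 5 (by omega)

/-- the permutation of the symmetric generators induced by `x` -/
def px : Equiv.Perm (Fin 14) where
  toFun := ![1, 2, 3, 4, 5, 6, 0, 8, 9, 10, 11, 12, 13, 7]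
  invFun := ![6, 0, 1, 2, 3, 4, 5, 13, 7, 8, 9, 10, 11, 12]
  left_inv := by decide
  right_inv := by decide

/-- the permutation of the symmetric generators induced by `y` -/
def py : Equiv.Perm (Fin 14) where
  toFun := ![11, 2, 1, 10, 7, 12, 6, 4, 9, 8, 3, 0, 5, 13]
  invFun := ![11, 2, 1, 10, 7, 12, 6, 4, 9, 8, 3, 0, 5, 13]
  left_inv := by decide
  right_inv := by decide

theorem cx_T (i : Fin 14) : cx (T i) = T (px i) := by
  obtain ⟨h0, h1, h2, h3, h4, h5, h6, h7⟩ := T_unfold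
  have h13 : cx (T 13) = T 7 := by
    rw [T13, T12, T11, T10, T9, T8, cx_seven]
  fin_cases i
  · change cx (T 0) = T 1
    rw [h0, h1]
  · change cx (T 1) = T 2
    rw [h1, h2]
  · change cx (T 2) = T 3
    rw [h2, h3]
  · change cx (T 3) = T 4
    rw [h3, h4]
  · change cx (T 4) = T 5
    rw [h4, h5]
  · change cx (T 5) = T 6
    rw [h5, h6, cx_seven]
  · change cx (T 6) = T 0
    rw [h6, h0]
  · exact T8.symm
  · exact T9.symm
  · exact T10.symm
  · exact T11.symm
  · exact T12.symm
  · exact T13.symm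
  · exact h13

theorem cy_T (i : Fin 14) : cy (T i) = T (py i) := by
  obtain ⟨h0, h1, -, -, -, -, h6, h7⟩ := T_unfold
  have x0 : cx (T 0) = T 1 := cx_T 0
  have x1 : cx (T 1) = T 2 := cx_T 1
  have x2 : cx (T 2) = T 3 := cx_T 2
  have x3 : cx (T 3) = T 4 := cx_T 3
  have x4 : cx (T 4) = T 5 := cx_T 4
  have x5 : cx (T 5) = T 6 := cx_T 5
  have x6 : cx (T 6) = T 0 := cx_T 6
  have x7 : cx (T 7) = T 8 := cx_T 7
  have x8 : cx (T 8) = T 9 := cx_T 8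
  have x9 : cx (T 9) = T 10 := cx_T 9
  have x10 : cx (T 10) = T 11 := cx_T 10
  have x11 : cx (T 11) = T 12 := cx_T 11
  have x12 : cx (T 12) = T 13 := cx_T 12
  have x13 : cx (T 13) = T 7 := cx_T 13
  have y6 : cy (T 6) = T 6 := by
    have h := t_y
    rw [h6, cy]
    rw [mul_assoc, mul_assoc, inv_mul_eq_one, ← mul_assoc] at h
    exact h.symm
  have y4 : cy (T 4) = T 7 := h7.symm
  have y7 : cy (T 7) = T 4 := by rw [h7, cy_cy]
  have y1 : cy (T 1) = T 2 := by
    have e : (x ^ 2)⁻¹ * t * x ^ 2 = T 1 := rfl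
    have h := t2_rel
    rw [e, mul_assoc, mul_assoc, inv_mul_eq_one, mul_inv_rev, inv_inv] at h
    have h' : cx (T 1) = cy (T 1) := by
      conv_lhs => rw [h]
      unfold cx cy; group
    rw [← h', x1]
  have y2 : cy (T 2) = T 1 := by rw [← y1, cy_cy]
  -- `(xy)^3 = 1` as `cx ∘ cy ∘ cx = cy ∘ cx⁻¹ ∘ cy`
  have key (a b : G) (h : cx b = cy a) : cx (cy (cx a)) = cy b := by
    have := c_cube a
    have h2 := c_cube b
    rw [h, cy_cy] at h2
    rw [← h2, cy_cy]
  have y10 : cy (T 10) = T 3 := by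
    have h := c_four (T 6)
    rw [y6, x6, x0, x1, y2, x1, x2, x3, y4, x7, x8, x9] at h
    apply cx_inj
    apply cx_inj
    apply cx_inj
    rw [h, x3, x4, x5]
  have y3 : cy (T 3) = T 10 := by rw [← y10, cy_cy]
  have y0 : cy (T 0) = T 11 := by
    rw [← key (T 2) (T 0) (by rw [x0, y2]), x2, y3, x10]
  have y5 : cy (T 5) = T 12 := by
    rw [← key (T 6) (T 5) (by rw [x5, y6]), x6, y0, x11]
  have y13 : cy (T 13) = T 13 := by
    rw [← key (T 4) (T 13) (by rw [x13, y4]), x4, y5, x12]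
  have y8 : cy (T 8) = T 9 := by
    apply cx_inj
    rw [x9, ← x7, key (T 7) (T 3) (by rw [x3, y7]), y3]
  have y9 : cy (T 9) = T 8 := by rw [← y8, cy_cy]
  have y11 : cy (T 11) = T 0 := by rw [← y0, cy_cy]
  have y12 : cy (T 12) = T 5 := by rw [← y5, cy_cy]
  fin_cases i
  · exact y0
  · exact y1
  · exact y2
  · exact y3
  · exact y4
  · exact y5
  · exact y6
  · exact y7
  · exact y8
  · exact y9
  · exact y10
  · exact y11
  · exact y12
  · exact y13

/-! ### Words in the symmetric generators -/

/-- the product of a word in the symmetric generators -/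
def ev (w : List (Fin 14)) : G := (w.map T).prod

theorem ev_append (u v : List (Fin 14)) : ev (u ++ v) = ev u * ev v := by
  simp [ev]

theorem ev_cons (a : Fin 14) (v : List (Fin 14)) : ev (a :: v) = T a * ev v := by
  simp [ev]

/-- `n ∈ N` induces the permutation `π` on the symmetric generators -/
def Acts (n : G) (π : Equiv.Perm (Fin 14)) : Prop :=
  n ∈ N ∧ ∀ i, n⁻¹ * T i * n = T (π i)

theorem acts_x : Acts x px := ⟨Subgroup.subset_closure (by simp), cx_T⟩
theorem acts_y : Acts y py := ⟨Subgroup.subset_closure (by simp), cy_T⟩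

theorem acts_one : Acts 1 1 := ⟨N.one_mem, by simp⟩

theorem Acts.mul {n m : G} {π ρ : Equiv.Perm (Fin 14)} (hn : Acts n π) (hm : Acts m ρ) :
    Acts (n * m) (ρ * π) := by
  refine ⟨N.mul_mem hn.1 hm.1, fun i => ?_⟩
  rw [Equiv.Perm.mul_apply, ← hm.2, ← hn.2]
  group

theorem Acts.inv {n : G} {π : Equiv.Perm (Fin 14)} (hn : Acts n π) : Acts n⁻¹ π⁻¹ := by
  refine ⟨N.inv_mem hn.1, fun i => ?_⟩
  have h := hn.2 (π⁻¹ i)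
  rw [← Equiv.Perm.mul_apply, mul_inv_cancel, Equiv.Perm.one_apply] at h
  rw [← h]
  group

theorem Acts.pow {n : G} {π : Equiv.Perm (Fin 14)} (hn : Acts n π) (k : ℕ) :
    Acts (n ^ k) (π ^ k) := by
  induction k with
  | zero => simpa using acts_one
  | succ k ih =>
    rw [pow_succ, pow_succ']
    exact ih.mul hn

theorem Acts.T_mul {n : G} {π : Equiv.Perm (Fin 14)} (hn : Acts n π) (i : Fin 14) :
    T i * n = n * T (π i) := by
  rw [← hn.2]; group

theorem Acts.ev_mul {n : G} {π : Equiv.Perm (Fin 14)} (hn : Acts n π) (w : List (Fin 14)) :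
    ev w * n = n * ev (w.map π) := by
  induction w with
  | nil => simp [ev]
  | cons a w ih => rw [List.map_cons, ev_cons, ev_cons, mul_assoc, ih, ← mul_assoc, hn.T_mul,
      mul_assoc]

theorem T_sq (i : Fin 14) : T i * T i = 1 := by
  have h : ∃ g : G, T i = g⁻¹ * t * g := by
    unfold T tt
    dsimp only
    split_ifs
    · exact ⟨_, rfl⟩
    · exact ⟨_, rfl⟩
  obtain ⟨g, hg⟩ := h
  have : g⁻¹ * t * g * (g⁻¹ * t * g) = g⁻¹ * (t * t) * g := by group
  rw [hg, this, t_sq]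
  simp

theorem ev_reverse (w : List (Fin 14)) : ev w.reverse = (ev w)⁻¹ := by
  induction w with
  | nil => simp [ev]
  | cons a w ih =>
    rw [List.reverse_cons, ev_append, ih, ev_cons a w, mul_inv_rev,
      inv_eq_of_mul_eq_one_right (T_sq a)]
    simp [ev]

/-- free reduction of words in the involutions -/
def push (a : Fin 14) : List (Fin 14) → List (Fin 14)
  | [] => [a]
  | b :: w => if a = b then w else a :: b :: w

/-- free reduction of words in the involutions -/
def red (w : List (Fin 14)) : List (Fin 14) := w.foldr push []

theorem ev_push (a : Fin 14) (w : List (Fin 14)) : ev (push a w) = T a * ev w := by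
  cases w with
  | nil => simp [push, ev]
  | cons b w =>
    rw [push]
    split_ifs with h
    · rw [← h, ev_cons, ← mul_assoc, T_sq, one_mul]
    · rw [ev_cons]

theorem ev_red (w : List (Fin 14)) : ev (red w) = ev w := by
  induction w with
  | nil => rfl
  | cons a w ih =>
    change ev (push a (red w)) = _
    rw [ev_push, ih, ev_cons]

/-- the word `w` is an element of `N` inducing `π` -/
def P (w : List (Fin 14)) (π : Equiv.Perm (Fin 14)) : Prop := Acts (ev w) π

theorem relI {w : List (Fin 14)} {π : Equiv.Perm (Fin 14)} (h : P w π) : P w.reverse π⁻¹ := by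
  unfold P
  rw [ev_reverse]
  exact h.inv

/-- the permutation induced by a word in `x` (`true`) and `y` (`false`) -/
def pw : List Bool → Equiv.Perm (Fin 14)
  | [] => 1
  | c :: h => pw h * (if c then px else py)

theorem exists_acts (h : List Bool) : ∃ n, Acts n (pw h) := by
  induction h with
  | nil => exact ⟨1, acts_one⟩
  | cons c h ih =>
    obtain ⟨n, hn⟩ := ih
    cases c
    · exact ⟨y * n, acts_y.mul hn⟩
    · exact ⟨x * n, acts_x.mul hn⟩

theorem ev_map {n : G} {π : Equiv.Perm (Fin 14)} (hn : Acts n π) (w : List (Fin 14)) :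
    ev (w.map π) = n⁻¹ * ev w * n := by
  rw [mul_assoc, hn.ev_mul]; group

theorem relC (h : List Bool) {w : List (Fin 14)} {π : Equiv.Perm (Fin 14)} (hw : P w π) :
    P (w.map (pw h)) (pw h * π * (pw h)⁻¹) := by
  obtain ⟨n, hn⟩ := exists_acts h
  unfold P
  rw [ev_map hn, mul_assoc]
  have := (hn.inv.mul hw).mul hn
  rwa [mul_assoc] at this ⊢

/-- the word `w` lies in `N` -/
def Q (w : List (Fin 14)) : Prop := ev w ∈ N

theorem Q_nil : Q [] := by
  simp [Q, ev, N.one_mem]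

theorem Q_map (h : List Bool) {w : List (Fin 14)} (hw : Q w) : Q (w.map (pw h)) := by
  obtain ⟨n, hn⟩ := exists_acts h
  unfold Q
  rw [ev_map hn]
  exact N.mul_mem (N.mul_mem (N.inv_mem hn.1) hw) hn.1

theorem step {w : List (Fin 14)} {π : Equiv.Perm (Fin 14)} (hw : P w π) (i l : ℕ)
    (W Z : List (Fin 14)) (h1 : (W.drop i).take l = w.take l)
    (h2 : red ((W.take i).map π ++ ((w.drop l).reverse ++ (W.drop i).drop l)) = Z)
    (hZ : Q Z) : Q W := by
  subst h2
  unfold Q at hZ ⊢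
  rw [ev_red, ev_append, ev_append, ev_reverse] at hZ
  have e1 : ev W = ev (W.take i) * (ev (w.take l) * ev ((W.drop i).drop l)) := by
    rw [← h1, ← ev_append, ← ev_append, List.take_append_drop, List.take_append_drop]
  have e2 : ev (w.take l) = ev w * (ev (w.drop l))⁻¹ := by
    rw [eq_mul_inv_iff_mul_eq, ← ev_append, List.take_append_drop]
  rw [e1, e2, mul_assoc, ← mul_assoc, Acts.ev_mul hw, mul_assoc]
  exact N.mul_mem hw.1 hZ

/-- the word with `(p * T a) ^ k = p ^ k * ev (powWord π a k)` when `p` induces `π` -/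
def powWord (π : Equiv.Perm (Fin 14)) (a : Fin 14) : ℕ → List (Fin 14)
  | 0 => []
  | k + 1 => (π ^ k) a :: powWord π a k

theorem pow_word {p : G} {π : Equiv.Perm (Fin 14)} (hp : Acts p π) (a : Fin 14) (k : ℕ) :
    (p * T a) ^ k = p ^ k * ev (powWord π a k) := by
  induction k with
  | zero => simp [powWord, ev]
  | succ k ih =>
    rw [pow_succ', ih, powWord, ev_cons, mul_assoc, ← mul_assoc (T a), (hp.pow k).T_mul,
      pow_succ']
    simp only [mul_assoc]

theorem base_rel {p : G} {π : Equiv.Perm (Fin 14)} (hp : Acts p π) (a : Fin 14) (k : ℕ)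
    (h : (p * T a) ^ k = 1) : P (powWord π a k) (π ^ k)⁻¹ := by
  rw [pow_word hp] at h
  unfold P
  rw [← inv_eq_of_mul_eq_one_right h]
  exact (hp.pow k).inv

theorem base0 : P [1, 2, 1, 2, 1] py := by
  have h := base_rel acts_y 1 5 rel_A
  have e1 : powWord py 1 5 = [1, 2, 1, 2, 1] := by decide
  have e2 : (py ^ 5)⁻¹ = py := by decide
  rwa [e1, e2] at h

theorem base1 : P [0, 11, 7, 4, 0] (px ^ 2 * py * px)⁻¹ := by
  have hp : Acts (x * y * x ^ 2) (px ^ 2 * (py * px)) := (acts_x.mul acts_y).mul (acts_x.pow 2)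
  have h0 : T 0 = x⁻¹ * t * x := T_unfold.1
  have h := base_rel hp 0 5 (by rw [h0]; exact rel_B)
  have e1 : powWord (px ^ 2 * (py * px)) 0 5 = [0, 11, 7, 4, 0] := by decide
  have e2 : ((px ^ 2 * (py * px)) ^ 5)⁻¹ = (px ^ 2 * py * px)⁻¹ := by decide
  rwa [e1, e2] at h

/-! ### The two representative triples -/

theorem mem_0_1_5_0_1 : Q [0, 1, 5, 0, 1] := by
  refine step (relC [false, true, true, false, true, true, false, true, true, true, false] base0) 0 1 [0, 1, 5, 0, 1] [0, 2, 0, 2, 1, 5, 0, 1] 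
    (by decide) (by decide) ?_
  refine step (relC [] base0) 4 1 [0, 2, 0, 2, 1, 5, 0, 1] [11, 1, 11, 2, 1, 2, 5, 0, 1] 
    (by decide) (by decide) ?_
  refine step (relC [false, true, true, true, false, true, true, true, true, true] (relI base1)) 3 1 [11, 1, 11, 2, 1, 2, 5, 0, 1] [5, 9, 5, 2, 8, 9, 2, 5, 0, 1] 
    (by decide) (by decide) ?_
  refine step (relC [false, true, false] base1) 2 2 [5, 9, 5, 2, 8, 9, 2, 5, 0, 1] [2, 9, 12, 8, 9, 2, 5, 0, 1] 
    (by decide) (by decide) ?_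
  refine step (relC [true, false] base1) 5 1 [2, 9, 12, 8, 9, 2, 5, 0, 1] [5, 12, 2, 13, 12, 2, 12, 9, 0, 1] 
    (by decide) (by decide) ?_
  refine step (relC [true, true, false, true, true, true, true, false, true, false] base0) 4 2 [5, 12, 2, 13, 12, 2, 12, 9, 0, 1] [9, 2, 12, 7, 12, 2, 9, 0, 1] 
    (by decide) (by decide) ?_
  refine step (relC [true, true, true, false] base0) 3 1 [9, 2, 12, 7, 12, 2, 9, 0, 1] [2, 9, 12, 7, 2, 9, 0, 1] 
    (by decide) (by decide) ?_
  refine step (relC [false, true, true, true, true, true] (relI base1)) 1 1 [2, 9, 12, 7, 2, 9, 0, 1] [5, 9, 5, 2, 7, 2, 9, 0, 1] 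
    (by decide) (by decide) ?_
  refine step (relC [true, true, true, true, true, false, true, true, true] base0) 3 1 [5, 9, 5, 2, 7, 2, 9, 0, 1] [12, 0, 12, 2, 7, 9, 0, 1] 
    (by decide) (by decide) ?_
  refine step (relC [true, true, false, true] base1) 3 1 [12, 0, 12, 2, 7, 9, 0, 1] [1, 2, 1, 2, 1] 
    (by decide) (by decide) ?_
  refine step (relC [] base0) 0 1 [1, 2, 1, 2, 1] [] 
    (by decide) (by decide) ?_
  exact Q_nil

theorem mem_0_1_12_0_1 : Q [0, 1, 12, 0, 1] := by
  refine step (relC [false, true, true, false, true, true, true, true, false] base0) 0 1 [0, 1, 12, 0, 1] [0, 4, 0, 4, 1, 12, 0, 1] 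
    (by decide) (by decide) ?_
  refine step (relC [true, false, true, true, false, true, true, true, true, false] base0) 3 1 [0, 4, 0, 4, 1, 12, 0, 1] [9, 1, 9, 4, 1, 4, 12, 0, 1] 
    (by decide) (by decide) ?_
  refine step (relC [true, true, true, true] (relI base1)) 3 1 [9, 1, 9, 4, 1, 4, 12, 0, 1] [12, 11, 12, 4, 8, 11, 4, 12, 0, 1] 
    (by decide) (by decide) ?_
  refine step (relC [true, true, true, false, true] (relI base1)) 1 2 [12, 11, 12, 4, 8, 11, 4, 12, 0, 1] [4, 11, 5, 8, 11, 4, 12, 0, 1] 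
    (by decide) (by decide) ?_
  refine step (relC [true, true, false, true, true, false, true, true] base1) 6 1 [4, 11, 5, 8, 11, 4, 12, 0, 1] [12, 5, 4, 3, 5, 4, 5, 11, 0, 1] 
    (by decide) (by decide) ?_
  refine step (relC [true, true, true] base0) 5 2 [12, 5, 4, 3, 5, 4, 5, 11, 0, 1] [11, 4, 5, 7, 5, 4, 11, 0, 1] 
    (by decide) (by decide) ?_
  refine step (relC [true, false, true, true, true, true] base0) 2 1 [11, 4, 5, 7, 5, 4, 11, 0, 1] [4, 11, 5, 7, 4, 11, 0, 1] 
    (by decide) (by decide) ?_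
  refine step (relC [true, true, true, false, true] base1) 1 1 [4, 11, 5, 7, 4, 11, 0, 1] [12, 11, 12, 4, 7, 4, 11, 0, 1] 
    (by decide) (by decide) ?_
  refine step (relC [true, true, false, true, true, true, false, true] base0) 4 1 [12, 11, 12, 4, 7, 4, 11, 0, 1] [5, 0, 5, 4, 7, 11, 0, 1] 
    (by decide) (by decide) ?_
  refine step (relC [] (relI base1)) 6 1 [5, 0, 5, 4, 7, 11, 0, 1] [1, 4, 1, 4, 1] 
    (by decide) (by decide) ?_
  refine step (relC [true, true, true, true, true, false, true, true, true, false] base0) 0 1 [1, 4, 1, 4, 1] [] 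
    (by decide) (by decide) ?_
  exact Q_nil

/-! ### All triples -/

/-- representatives of the cosets of `⟨x⟩` in `N` -/
def reps : List (List Bool) :=
  [[],
  [false],
  [true, false],
  [true, true, false],
  [false, true, false],
  [true, true, true, false],
  [false, true, true, false],
  [true, true, true, true, false],
  [true, false, true, true, false],
  [false, true, true, true, false],
  [true, true, true, true, true, false],
  [true, true, false, true, true, false],
  [true, false, true, true, true, false],
  [false, true, true, true, true, false],
  [true, true, true, false, true, true, false],
  [true, true, false, true, true, true, false],
  [true, false, true, true, true, true, false],
  [false, true, false, true, true, true, false],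
  [true, true, true, true, false, true, true, false],
  [true, true, false, true, true, true, true, false],
  [false, true, true, true, false, true, true, false],
  [false, true, false, true, true, true, true, false],
  [false, true, true, true, true, false, true, true, false],
  [false, true, true, false, true, true, true, true, false]]

/-- words for all the elements of `N` -/
def allWords : List (List Bool) :=
  reps.flatMap fun r => (List.range 7).map fun k => r ++ List.replicate k true

theorem Q_triple (h : List Bool) (c : Fin 14) (hc : c = 5 ∨ c = 12) :
    tt (pw h 0 + 1) * tt (pw h 1 + 1) * tt (pw h c + 1) * tt (pw h 0 + 1) * tt (pw h 1 + 1) ∈ N := by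
  have hq : Q [0, 1, c, 0, 1] := by
    rcases hc with rfl | rfl
    · exact mem_0_1_5_0_1
    · exact mem_0_1_12_0_1
  have h2 := Q_map h hq
  simpa only [Q, ev, T, List.map_cons, List.map_nil, List.prod_cons, List.prod_nil, mul_one,
    mul_assoc] using h2

/-- the table of all triples reached from the two representatives -/
def table : List (ℕ × ℕ × ℕ × ℕ) :=
  allWords.map fun h => ((pw h 0 : ℕ) + 1, (pw h 1 : ℕ) + 1, (pw h 5 : ℕ) + 1, (pw h 12 : ℕ) + 1)

theorem table_complete :
    ∀ i ∈ Finset.Icc 1 14, ∀ j ∈ Finset.Icc 1 14, ∀ k ∈ Finset.Icc 1 14,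
      red7 i ≠ red7 j → red7 i ≠ red7 k → red7 j ≠ red7 k →
      (∃ m ∈ Finset.Icc 1 7,
        ({red7 i, red7 j, red7 k} : Finset ℕ) = {red7 m, red7 (m + 2), red7 (m + 3)}) →
      ∃ q ∈ table, q.1 = i ∧ q.2.1 = j ∧ (q.2.2.1 = k ∨ q.2.2.2 = k) := by
  decide +kernel

/-- If `i, j, k ∈ {1, …, 14}` have pairwise distinct residues modulo `7` which
form a line of the Fano plane, then `tᵢ tⱼ tₖ tᵢ tⱼ ∈ N = ⟨x, y⟩`. -/
theorem gamma_relation :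
    ∀ i ∈ Finset.Icc 1 14, ∀ j ∈ Finset.Icc 1 14, ∀ k ∈ Finset.Icc 1 14,
      red7 i ≠ red7 j → red7 i ≠ red7 k → red7 j ≠ red7 k →
      IsFanoLine (red7 i) (red7 j) (red7 k) →
      tt i * tt j * tt k * tt i * tt j ∈ N := by
  intro i hi j hj k hk hij hik hjk hl
  obtain ⟨q, hq, rfl, rfl, h3⟩ := table_complete i hi j hj k hk hij hik hjk hl
  obtain ⟨h, -, rfl⟩ := List.mem_map.1 hq
  rcases h3 with rfl | rfl
  · exact Q_triple h 5 (Or.inl rfl)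
  · exact Q_triple h 12 (Or.inr rfl)

end M22
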